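/- arXiv:1203.2659 — 3 statements merged into one kernel-verified Lean document; each statement's English description precedes it below -/
import Mathlib

section
/- For every integer λ and every ε > 0 there exists δ > 0 such that the following holds for every sufficiently large prime p: there exists a set A ⊆ ℤ/pℤ with |A| ≥ (1/2 − ε)·p and |A + λ·A| ≤ (1 − δ)·p. -/
open Pointwise

namespace DilatesAux

/-- Hitting exactly at time `n`. -/
def Hit {α : Type*} (T : α → α) (B : Finset α) (n : ℕ) (x : α) : Prop :=
  T^[n] x ∈ B ∧ ∀ i < n, T^[i] x ∉ B

lemma hit_unique {α : Type*} {T : α → α} {B : Finset α} {n n' : ℕ} {x : α}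
    (h : Hit T B n x) (h' : Hit T B n' x) : n = n' := by
  rcases lt_trichotomy n n' with h1 | h1 | h1
  · exact absurd h.1 (h'.2 n h1)
  · exact h1
  · exact absurd h'.1 (h.2 n' h1)

open Classical in
lemma card_pre {α : Type*} [Fintype α] (T : α → α) (hT : Function.Bijective T) (S : Finset α) :
    (Finset.univ.filter fun x => T x ∈ S).card = S.card := by
  apply Finset.card_bij (fun x _ => T x)
  · intro x hx; simpa using hx
  · intro x _ y _ h; exact hT.1 h
  · intro y hy
    obtain ⟨x, rfl⟩ := hT.2 y
    exact ⟨x, by simpa using hy, rfl⟩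

open Classical in
lemma rokhlin {α : Type*} [Fintype α] (T : α → α) (hT : Function.Bijective T)
    (B : Finset α) (N : ℕ) :
    Fintype.card α ≤ 2 * (Finset.univ.filter fun x => ∃ n ≤ N, Odd n ∧ Hit T B n x).card
      + B.card + (Finset.univ.filter fun x => ∀ i < N, T^[i] x ∉ B).card := by
  set A0 := Finset.univ.filter fun x => ∃ n ≤ N, Odd n ∧ Hit T B n x with hA0
  set E := Finset.univ.filter fun x => ∃ n < N, Even n ∧ Hit T B n x with hE
  set U := Finset.univ.filter fun x => ∀ i < N, T^[i] x ∉ B with hU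
  have h1 : (Finset.univ : Finset α) ⊆ (A0 ∪ E) ∪ U := by
    intro x _
    by_cases hx : ∃ i, i < N ∧ T^[i] x ∈ B
    · apply Finset.mem_union_left
      have hs := Nat.find_spec hx
      have hm : Hit T B (Nat.find hx) x := by
        refine ⟨hs.2, fun i hi hb => ?_⟩
        exact Nat.find_min hx hi ⟨hi.trans hs.1, hb⟩
      rcases Nat.even_or_odd (Nat.find hx) with h | h
      · apply Finset.mem_union_right
        simp only [hE, Finset.mem_filter, Finset.mem_univ, true_and]
        exact ⟨_, hs.1, h, hm⟩
      · apply Finset.mem_union_left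
        simp only [hA0, Finset.mem_filter, Finset.mem_univ, true_and]
        exact ⟨_, hs.1.le, h, hm⟩
    · apply Finset.mem_union_right
      push Not at hx
      simpa [hU] using hx
  have h2 : (Finset.univ.filter fun x => T x ∈ E) ⊆ A0 ∪ B := by
    intro x hx
    simp only [hE, Finset.mem_filter, Finset.mem_univ, true_and] at hx
    obtain ⟨n, hn, hev, hh⟩ := hx
    by_cases hb : x ∈ B
    · exact Finset.mem_union_right _ hb
    · apply Finset.mem_union_left
      simp only [hA0, Finset.mem_filter, Finset.mem_univ, true_and]
      refine ⟨n + 1, hn, hev.add_one, ?_, ?_⟩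
      · exact hh.1
      · intro i hi
        cases i with
        | zero => simpa using hb
        | succ j => exact hh.2 j (by omega)
  have h3 := Finset.card_le_card h1
  have h4 := Finset.card_le_card h2
  rw [card_pre T hT] at h4
  have h5 := Finset.card_union_le A0 B
  have h6 := Finset.card_union_le (A0 ∪ E) U
  have h7 := Finset.card_union_le A0 E
  rw [Finset.card_univ] at h3
  omega

open Classical in
lemma remove_bad {α : Type*} [Fintype α] (T : α → α) (hT : Function.Bijective T)
    (D : Finset α) (N : ℕ) (A0 : Finset α) :
    A0.card ≤ (A0.filter fun x => ∀ i < N + 1, T^[i] x ∉ D).card + (N + 1) * D.card := by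
  have h1 : A0 ⊆ (A0.filter fun x => ∀ i < N + 1, T^[i] x ∉ D) ∪
      (Finset.range (N + 1)).biUnion (fun i => Finset.univ.filter fun x => T^[i] x ∈ D) := by
    intro x hx
    by_cases h : ∀ i < N + 1, T^[i] x ∉ D
    · apply Finset.mem_union_left
      exact Finset.mem_filter.2 ⟨hx, h⟩
    · apply Finset.mem_union_right
      push Not at h
      obtain ⟨i, hi, hd⟩ := h
      simp only [Finset.mem_biUnion, Finset.mem_range, Finset.mem_filter, Finset.mem_univ, true_and]
      exact ⟨i, hi, hd⟩
  refine (Finset.card_le_card h1).trans ((Finset.card_union_le _ _).trans ?_)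
  gcongr
  refine (Finset.card_biUnion_le_card_mul _ _ D.card ?_).trans (by simp)
  intro i _
  exact (card_pre _ (hT.iterate i) D).le

lemma fiber_card (p M : ℕ) (hp : 0 < p) (hM : 0 < M) (S : Finset ℕ)
    (h : ∀ x ∈ S, ∀ y ∈ S, M * x / p = M * y / p) : S.card ≤ p / M + 1 := by
  rcases S.eq_empty_or_nonempty with rfl | hS
  · simp
  set a := S.min' hS
  have ha : a ∈ S := S.min'_mem hS
  have hsub : S ⊆ Finset.Icc a (a + p / M) := by
    intro x hx
    have hle : a ≤ x := S.min'_le x hx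
    rw [Finset.mem_Icc]
    refine ⟨hle, ?_⟩
    have he := h a ha x hx
    obtain ⟨d, rfl⟩ := Nat.exists_eq_add_of_le hle
    have h1 : d ≤ p / M := by
      rw [Nat.le_div_iff_mul_le hM]
      have e1 := Nat.div_add_mod (M * a) p
      have e2 := Nat.div_add_mod (M * (a + d)) p
      have e3 := Nat.mod_lt (M * (a + d)) hp
      rw [← he] at e2
      generalize M * (a + d) % p = r at e2 e3
      generalize M * a % p = s at e1
      generalize M * a / p = q at e1 e2
      nlinarith
    omega
  refine (Finset.card_le_card hsub).trans ?_
  simp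
  omega

lemma unhit_nat (p Q R : ℕ) (hp : 0 < p) (hQ : 0 < Q) :
    ((Finset.range p).filter fun x => ∀ j < R, p ≤ Q * ((Q ^ j * x) % p)).card
      ≤ (p / Q ^ R + 1) * (Q - 1) ^ R := by
  set S := (Finset.range p).filter fun x => ∀ j < R, p ≤ Q * ((Q ^ j * x) % p) with hS
  have hstep : ∀ j x : ℕ, Q ^ (j + 1) * x / p = Q * (Q ^ j * x / p) + Q * ((Q ^ j * x) % p) / p := by
    intro j x
    have e1 := Nat.div_add_mod (Q ^ j * x) p
    have : Q ^ (j + 1) * x = Q * ((Q ^ j * x) % p) + p * (Q * (Q ^ j * x / p)) := by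
      calc Q ^ (j + 1) * x = Q * (Q ^ j * x) := by ring
        _ = Q * (p * (Q ^ j * x / p) + (Q ^ j * x) % p) := by rw [e1]
        _ = _ := by ring
    rw [this, Nat.add_mul_div_left _ _ hp, add_comm]
  let f : ℕ → (Fin R → ℕ) := fun x j => Q * ((Q ^ (j : ℕ) * x) % p) / p
  have hmap : ∀ x ∈ S, f x ∈ Fintype.piFinset (fun _ : Fin R => Finset.Ioo 0 Q) := by
    intro x hx
    rw [Fintype.mem_piFinset]
    intro j
    rw [Finset.mem_Ioo]
    have hx2 := (Finset.mem_filter.1 hx).2 j j.2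
    refine ⟨Nat.div_pos hx2 hp, ?_⟩
    rw [Nat.div_lt_iff_lt_mul hp]
    exact Nat.mul_lt_mul_of_pos_left (Nat.mod_lt _ hp) hQ
  have hmain := Finset.card_le_mul_card_image_of_maps_to hmap (p / Q ^ R + 1) (by
    intro b _
    apply fiber_card p (Q ^ R) hp (by positivity)
    intro x hx y hy
    have hxy : f x = f y := by
      rw [(Finset.mem_filter.1 hx).2, (Finset.mem_filter.1 hy).2]
    have hx' : x < p := Finset.mem_range.1 (Finset.mem_filter.1 (Finset.mem_filter.1 hx).1).1
    have hy' : y < p := Finset.mem_range.1 (Finset.mem_filter.1 (Finset.mem_filter.1 hy).1).1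
    have : ∀ j ≤ R, Q ^ j * x / p = Q ^ j * y / p := by
      intro j
      induction j with
      | zero => intro _; simp [Nat.div_eq_of_lt hx', Nat.div_eq_of_lt hy']
      | succ j ih =>
        intro hj
        rw [hstep, hstep, ih (by omega)]
        have := congrFun hxy ⟨j, by omega⟩
        simp only [f] at this
        rw [this]
    exact this R le_rfl)
  simpa using hmain

/-- Small interval. -/
def Bset (p b : ℕ) [NeZero p] : Finset (ZMod p) := Finset.univ.filter fun x => x.val < b

/-- Points near the boundary of the interval. -/
def Dset (p b K : ℕ) [NeZero p] : Finset (ZMod p) :=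
  Finset.univ.filter fun x => x.val ≤ K ∨ p ≤ x.val + K ∨ (x.val ≤ b + K ∧ b ≤ x.val + K)

lemma card_B (p b : ℕ) [NeZero p] : (Bset p b).card ≤ b := by
  have : ((Bset p b).image ZMod.val) ⊆ Finset.range b := by
    intro v hv
    obtain ⟨x, hx, rfl⟩ := Finset.mem_image.1 hv
    simpa [Bset] using hx
  have h := Finset.card_le_card this
  rwa [Finset.card_image_of_injective _ (ZMod.val_injective p), Finset.card_range] at h

lemma card_D (p b K : ℕ) [NeZero p] : (Dset p b K).card ≤ 4 * K + 2 := by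
  have : ((Dset p b K).image ZMod.val) ⊆
      (Finset.range (K + 1) ∪ Finset.Ico (p - K) p) ∪ Finset.Icc (b - K) (b + K) := by
    intro v hv
    obtain ⟨x, hx, rfl⟩ := Finset.mem_image.1 hv
    have hlt := ZMod.val_lt x
    simp only [Dset, Finset.mem_filter, Finset.mem_univ, true_and] at hx
    simp only [Finset.mem_union, Finset.mem_range, Finset.mem_Ico, Finset.mem_Icc]
    omega
  have h := Finset.card_le_card this
  rw [Finset.card_image_of_injective _ (ZMod.val_injective p)] at h
  have h1 := Finset.card_union_le (Finset.range (K + 1) ∪ Finset.Ico (p - K) p)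
    (Finset.Icc (b - K) (b + K))
  have h2 := Finset.card_union_le (Finset.range (K + 1)) (Finset.Ico (p - K) p)
  simp only [Finset.card_range, Nat.card_Ico, Nat.card_Icc] at h1 h2
  omega

lemma shift_B (p b K : ℕ) [NeZero p] (x : ZMod p) (hx : x ∉ Dset p b K) (c : ℤ)
    (hc : |c| ≤ K) : x + (c : ZMod p) ∈ Bset p b ↔ x ∈ Bset p b := by
  have hlt := ZMod.val_lt x
  simp only [Dset, Finset.mem_filter, Finset.mem_univ, true_and, not_or, not_and, not_le] at hx
  obtain ⟨h1, h2, h3⟩ := hx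
  rw [abs_le] at hc
  have hv : (x + (c : ZMod p)).val = ((x.val : ℤ) + c).toNat := by
    have e : x + (c : ZMod p) = ((((x.val : ℤ) + c).toNat : ℕ) : ZMod p) := by
      have : ((((x.val : ℤ) + c).toNat : ℤ) : ZMod p) = (((x.val : ℤ) + c : ℤ) : ZMod p) := by
        rw [Int.toNat_of_nonneg (by omega)]
      rw [Int.cast_natCast] at this
      rw [this]
      simp
    rw [e, ZMod.val_natCast, Nat.mod_eq_of_lt (by omega)]
  simp only [Bset, Finset.mem_filter, Finset.mem_univ, true_and, hv]
  omega

lemma iter_mul {p : ℕ} (μ : ℤ) (n : ℕ) (x : ZMod p) :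
    (fun y : ZMod p => (μ : ZMod p) * y)^[n] x = (μ : ZMod p) ^ n * x := by
  induction n with
  | zero => simp
  | succ n ih => rw [Function.iterate_succ_apply', ih]; ring

/-- The finite combinatorial core. -/
lemma core (l : ℤ) (k R H p : ℕ) (hp : p.Prime) (hl : l ≠ 0) (hlp : l.natAbs < p)
    (hk : 0 < k) (hH : H < p) :
    ∃ A : Finset (ZMod p),
      p ≤ 2 * (A.card + (2 * k * R + 1) * (4 * (l.natAbs ^ (2 * k * R) * H) + 2))
          + (p / l.natAbs ^ (2 * k) + 1)
          + (p / (l.natAbs ^ (2 * k)) ^ R + 1) * (l.natAbs ^ (2 * k) - 1) ^ R ∧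
      (A + A.image fun a => l • a).card + (H + 1) ≤ p := by
  classical
  have : Fact p.Prime := ⟨hp⟩
  set m := l.natAbs with hm
  have hm0 : 0 < m := Int.natAbs_pos.2 hl
  set Q := m ^ (2 * k) with hQ
  have hQ0 : 0 < Q := by positivity
  set N := 2 * k * R with hN
  set K := m ^ N * H with hK
  set b := p / Q + 1 with hb
  set μ : ℤ := -l with hμ
  have hμ0 : (μ : ZMod p) ≠ 0 := by
    rw [Ne, ZMod.intCast_zmod_eq_zero_iff_dvd]
    intro hd
    have h1 := Int.natAbs_dvd_natAbs.2 hd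
    have h2 := Nat.le_of_dvd (by rw [hμ, Int.natAbs_neg]; exact hm0) h1
    rw [hμ, Int.natAbs_neg, Int.natAbs_natCast] at h2
    omega
  set T : ZMod p → ZMod p := fun y => (μ : ZMod p) * y with hT
  have hTb : Function.Bijective T := mulLeft_bijective₀ _ hμ0
  have hTi : ∀ n x, T^[n] x = (μ : ZMod p) ^ n * x := fun n x => iter_mul μ n x
  set B := Bset p b with hB
  set D := Dset p b K with hD
  set A0 : Finset (ZMod p) := Finset.univ.filter fun x => ∃ n ≤ N, Odd n ∧ Hit T B n x with hA0
  set A := A0.filter fun x => ∀ i < N + 1, T^[i] x ∉ D with hA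
  refine ⟨A, ?_, ?_⟩
  · have h1 : Fintype.card (ZMod p) ≤ 2 * A0.card + B.card +
        (Finset.univ.filter fun x => ∀ i < N, T^[i] x ∉ B).card := by
      convert rokhlin T hTb B N
    have h2 : A0.card ≤ A.card + (N + 1) * D.card := by
      convert remove_bad T hTb D N A0
    have h3 : B.card ≤ b := card_B p b
    have h4 : D.card ≤ 4 * K + 2 := card_D p b K
    have h5 : (Finset.univ.filter fun x => ∀ i < N, T^[i] x ∉ B).card
        ≤ (p / Q ^ R + 1) * (Q - 1) ^ R := by
      refine le_trans ?_ (unhit_nat p Q R hp.pos hQ0)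
      rw [← Finset.card_image_of_injective _ (ZMod.val_injective p)]
      apply Finset.card_le_card
      intro v hv
      obtain ⟨x, hx, rfl⟩ := Finset.mem_image.1 hv
      simp only [Finset.mem_filter, Finset.mem_univ, true_and] at hx
      rw [Finset.mem_filter, Finset.mem_range]
      refine ⟨ZMod.val_lt x, fun j hj => ?_⟩
      have hx1 := hx (2 * k * j) (by rw [hN]; exact Nat.mul_lt_mul_of_pos_left hj (by omega))
      rw [hTi] at hx1
      have hcast : (μ : ZMod p) ^ (2 * k * j) * x = ((Q ^ j * x.val : ℕ) : ZMod p) := by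
        have e : μ ^ (2 * k * j) = ((Q ^ j : ℕ) : ℤ) := by
          rw [hQ]
          push_cast
          rw [← pow_mul, hm, hμ, mul_assoc 2 k j, pow_mul (-l), pow_mul _ 2 (k * j), neg_sq, Int.natCast_natAbs, sq_abs]
        have e2 : (μ : ZMod p) ^ (2 * k * j) = ((Q ^ j : ℕ) : ZMod p) := by
          have := congrArg (Int.cast : ℤ → ZMod p) e
          simpa using this
        rw [e2]
        push_cast
        simp
      rw [hcast] at hx1
      simp only [hB, Bset, Finset.mem_filter, Finset.mem_univ, true_and, ZMod.val_natCast,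
        not_lt] at hx1
      have := Nat.lt_mul_div_succ p hQ0
      calc p ≤ Q * b := this.le
        _ ≤ _ := Nat.mul_le_mul_left _ hx1
    rw [ZMod.card] at h1
    have h6 : (N + 1) * D.card ≤ (N + 1) * (4 * K + 2) := Nat.mul_le_mul_left _ h4
    omega
  · set C : Finset (ZMod p) := (Finset.range (H + 1)).image (fun c : ℕ => (c : ZMod p)) with hC
    have hCc : C.card = H + 1 := by
      rw [hC, Finset.card_image_of_injOn, Finset.card_range]
      intro x hx y hy hxy
      simp only [Finset.coe_range, Set.mem_Iio] at hx hy
      have := congrArg ZMod.val hxy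
      simp only [ZMod.val_natCast] at this
      rwa [Nat.mod_eq_of_lt (by omega), Nat.mod_eq_of_lt (by omega)] at this
    have hdisj : Disjoint (A + A.image fun a => l • a) C := by
      rw [Finset.disjoint_left]
      intro z hz hzC
      obtain ⟨a, ha, b', hb', rfl⟩ := Finset.mem_add.1 hz
      obtain ⟨x, hx, rfl⟩ := Finset.mem_image.1 hb'
      obtain ⟨c, hc, hce⟩ := Finset.mem_image.1 hzC
      rw [Finset.mem_range] at hc
      have hax : a = (μ : ZMod p) * x + (c : ZMod p) := by
        rw [hce, hμ, zsmul_eq_mul]; push_cast; ring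
      obtain ⟨hx0, hxD⟩ := Finset.mem_filter.1 hx
      obtain ⟨n, hn, hodd, hhit⟩ := (Finset.mem_filter.1 hx0).2
      obtain ⟨n', hn', hodd', hhit'⟩ := (Finset.mem_filter.1 (Finset.mem_filter.1 ha).1).2
      have key : ∀ j, j + 1 ≤ N → (T^[j] a ∈ B ↔ T^[j + 1] x ∈ B) := by
        intro j hj
        have e : T^[j] a = T^[j + 1] x + ((μ ^ j * c : ℤ) : ZMod p) := by
          rw [hTi, hTi, hax]; push_cast; ring
        rw [e]
        apply shift_B p b K _ (hxD (j + 1) (by omega))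
        rw [abs_mul, abs_pow, hμ, abs_neg, ← Int.natCast_natAbs l, ← hm, Nat.abs_cast]
        have : m ^ j * c ≤ K := Nat.mul_le_mul (Nat.pow_le_pow_right hm0 (by omega)) (by omega)
        exact_mod_cast this
      obtain ⟨q, rfl⟩ : ∃ q, n = q + 1 := ⟨n - 1, by have := hodd.pos; omega⟩
      have hq : Hit T B q a := by
        refine ⟨(key q hn).2 hhit.1, fun i hi h => ?_⟩
        exact hhit.2 (i + 1) (by omega) ((key i (by omega)).1 h)
      have := hit_unique hq hhit'
      subst this
      rw [Nat.odd_add_one] at hodd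
      exact hodd hodd'
    rw [← hCc, ← Finset.card_union_of_disjoint hdisj]
    exact (Finset.card_le_univ _).trans (ZMod.card p).le

/-- The case `|l| ≥ 2`. -/
lemma big_case (l : ℤ) (hl : 2 ≤ l.natAbs) (ε : ℝ) (hε : 0 < ε) (hε1 : ε ≤ 1) :
    ∃ δ : ℝ, 0 < δ ∧ ∃ p₀ : ℕ, ∀ p : ℕ, p.Prime → p₀ ≤ p →
      ∃ A : Finset (ZMod p),
        (1 / 2 - ε) * p ≤ (A.card : ℝ) ∧
        (((A + A.image fun a => l • a).card : ℝ)) ≤ (1 - δ) * p := by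
  set m := l.natAbs with hm
  obtain ⟨k, hk⟩ : ∃ k : ℕ, 4 / ε < (2 : ℝ) ^ k := pow_unbounded_of_one_lt _ (by norm_num)
  have hk0 : 0 < k := by
    rcases Nat.eq_zero_or_pos k with rfl | h
    · exfalso
      have : (4 : ℝ) ≤ 4 / ε := by rw [le_div_iff₀ hε]; linarith
      norm_num at hk; linarith
    · exact h
  set Q := m ^ (2 * k) with hQ
  have hQ0 : 0 < Q := by positivity
  have hQbig : 4 / ε < (Q : ℝ) := by
    refine hk.trans_le ?_
    have : 2 ^ k ≤ Q := (Nat.pow_le_pow_left hl k).trans (Nat.pow_le_pow_right (by omega) (by omega))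
    exact_mod_cast this
  have hQr : (0 : ℝ) < Q := by exact_mod_cast hQ0
  have hQ1 : (1 : ℝ) / Q ≤ ε / 4 := by
    rw [div_lt_iff₀ hε] at hQbig
    rw [div_le_div_iff₀ hQr (by norm_num)]
    linarith
  obtain ⟨R, hR⟩ : ∃ R : ℕ, (((Q - 1 : ℕ) : ℝ) / Q) ^ R < ε / 4 := by
    apply exists_pow_lt_of_lt_one (by positivity)
    rw [div_lt_one hQr]
    have : Q - 1 < Q := by omega
    exact_mod_cast this
  set N := 2 * k * R with hN
  set W : ℝ := ((N : ℝ) + 1) * (m : ℝ) ^ N with hW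
  have hm1 : (1 : ℝ) ≤ m := by exact_mod_cast (by omega : 1 ≤ m)
  have hmN : (1 : ℝ) ≤ (m : ℝ) ^ N := one_le_pow₀ hm1
  have hW1 : 1 ≤ W := by
    have : (0 : ℝ) ≤ N := Nat.cast_nonneg N
    rw [hW]; nlinarith
  set η : ℝ := ε / (100 * W) with hη
  have hη0 : 0 < η := by positivity
  have hηW : η * W = ε / 100 := by rw [hη]; field_simp
  have hη1 : η < 1 := by nlinarith
  set c0 : ℝ := 1 + (Q : ℝ) ^ R + 4 * ((N : ℝ) + 1) with hc0
  refine ⟨η, hη0, max (m + 1) ⌈10 * c0 / ε⌉₊, fun p hp hpp => ?_⟩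
  have hpm : m < p := by have := le_max_left (m + 1) ⌈10 * c0 / ε⌉₊; omega
  have hpc : 10 * c0 ≤ p * ε := by
    have h1 : 10 * c0 / ε ≤ p :=
      (Nat.le_ceil _).trans (by exact_mod_cast (le_max_right _ _).trans hpp)
    rwa [div_le_iff₀ hε] at h1
  have hp0 : (0 : ℝ) < p := by exact_mod_cast hp.pos
  have hHf := Nat.floor_le (show 0 ≤ η * p by positivity)
  have hHc := Nat.lt_floor_add_one (η * p)
  set H := ⌊η * p⌋₊ with hH
  have hHp : H < p := by
    have : (H : ℝ) < p := by nlinarith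
    exact_mod_cast this
  obtain ⟨A, hA1, hA2⟩ := core l k R H p hp (by omega) hpm hk0 hHp
  rw [← hm, ← hQ, ← hN] at hA1
  refine ⟨A, ?_, ?_⟩
  · have hA1r : (p : ℝ) ≤ 2 * (A.card + (N + 1) * (4 * ((m : ℝ) ^ N * H) + 2))
          + (((p / Q : ℕ) : ℝ) + 1)
          + (((p / Q ^ R : ℕ) : ℝ) + 1) * ((Q - 1 : ℕ) : ℝ) ^ R := by exact_mod_cast hA1
    have e1 : ((p / Q : ℕ) : ℝ) ≤ p * (ε / 4) := by
      refine Nat.cast_div_le.trans ?_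
      rw [div_eq_mul_one_div]
      gcongr
    have e2 : ((p / Q ^ R : ℕ) : ℝ) ≤ p / (Q : ℝ) ^ R := by
      refine Nat.cast_div_le.trans ?_
      push_cast; rfl
    have e3 : ((Q - 1 : ℕ) : ℝ) ^ R ≤ (Q : ℝ) ^ R := by
      gcongr; omega
    have e4 : ((p / Q ^ R : ℕ) : ℝ) * ((Q - 1 : ℕ) : ℝ) ^ R ≤ p * (ε / 4) := by
      calc ((p / Q ^ R : ℕ) : ℝ) * ((Q - 1 : ℕ) : ℝ) ^ R
          ≤ p / (Q : ℝ) ^ R * ((Q - 1 : ℕ) : ℝ) ^ R := by gcongr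
        _ = p * (((Q - 1 : ℕ) : ℝ) / Q) ^ R := by rw [div_pow]; ring
        _ ≤ _ := by gcongr
    have e5 : ((N : ℝ) + 1) * ((m : ℝ) ^ N * H) ≤ ε / 100 * p := by
      calc ((N : ℝ) + 1) * ((m : ℝ) ^ N * H) = W * H := by rw [hW]; ring
        _ ≤ W * (η * p) := by gcongr
        _ = _ := by rw [← hηW]; ring
    nlinarith
  · have : ((A + A.image fun a => l • a).card : ℝ) + (H + 1) ≤ p := by exact_mod_cast hA2
    linarith

lemma small_case (l : ℤ) (hl : l.natAbs ≤ 1) (ε : ℝ) (hε : 0 < ε) (hε1 : ε ≤ 1) :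
    ∃ δ : ℝ, 0 < δ ∧ ∃ p₀ : ℕ, ∀ p : ℕ, p.Prime → p₀ ≤ p →
      ∃ A : Finset (ZMod p),
        (1 / 2 - ε) * p ≤ (A.card : ℝ) ∧
        (((A + A.image fun a => l • a).card : ℝ)) ≤ (1 - δ) * p := by
  refine ⟨ε, hε, ⌈2 / ε⌉₊, fun p hp hpp => ?_⟩
  have hpc : 2 ≤ p * ε := by
    have h1 : 2 / ε ≤ p := (Nat.le_ceil _).trans (by exact_mod_cast hpp)
    rwa [div_le_iff₀ hε] at h1
  have hp0 : (0 : ℝ) < p := by exact_mod_cast hp.pos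
  have hf := Nat.floor_le (show 0 ≤ (1 / 2 - ε / 2) * p by
    apply mul_nonneg <;> linarith)
  have hc := Nat.lt_floor_add_one ((1 / 2 - ε / 2) * p)
  set n := ⌊(1 / 2 - ε / 2) * p⌋₊ with hn
  have hnp : n < p := by
    have : (n : ℝ) < p := by nlinarith
    exact_mod_cast this
  refine ⟨(Finset.range n).image (fun c : ℕ => (c : ZMod p)), ?_, ?_⟩
  · rw [Finset.card_image_of_injOn, Finset.card_range]
    · nlinarith
    · intro x hx y hy hxy
      simp only [Finset.coe_range, Set.mem_Iio] at hx hy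
      have := congrArg ZMod.val hxy
      simp only [ZMod.val_natCast] at this
      rwa [Nat.mod_eq_of_lt (by omega), Nat.mod_eq_of_lt (by omega)] at this
  · set A : Finset (ZMod p) := (Finset.range n).image (fun c : ℕ => (c : ZMod p)) with hA
    obtain ⟨lo, hlo⟩ : ∃ lo : ℤ, ∀ i j : ℕ, i < n → j < n →
        lo ≤ i + l * j ∧ (i + l * j : ℤ) < lo + 2 * n := by
      have : l = 0 ∨ l = 1 ∨ l = -1 := by omega
      rcases this with rfl | rfl | rfl
      · exact ⟨0, fun i j hi hj => by omega⟩
      · exact ⟨0, fun i j hi hj => by omega⟩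
      · exact ⟨-n, fun i j hi hj => by omega⟩
    have hsub : (A + A.image fun a => l • a) ⊆
        (Finset.Ico lo (lo + 2 * n)).image (fun c : ℤ => (c : ZMod p)) := by
      intro z hz
      obtain ⟨a, ha, b', hb', rfl⟩ := Finset.mem_add.1 hz
      obtain ⟨x, hx, rfl⟩ := Finset.mem_image.1 hb'
      obtain ⟨i, hi, rfl⟩ := Finset.mem_image.1 ha
      obtain ⟨j, hj, rfl⟩ := Finset.mem_image.1 hx
      rw [Finset.mem_range] at hi hj
      refine Finset.mem_image.2 ⟨i + l * j, Finset.mem_Ico.2 (hlo i j hi hj), ?_⟩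
      rw [zsmul_eq_mul]; push_cast; ring
    have h1 := (Finset.card_le_card hsub).trans Finset.card_image_le
    rw [Int.card_Ico] at h1
    have h2 : (A + A.image fun a => l • a).card ≤ 2 * n := by omega
    have h3 : ((A + A.image fun a => l • a).card : ℝ) ≤ 2 * n := by exact_mod_cast h2
    linarith

end DilatesAux

theorem sums_of_dilates_large_density (l : ℤ) (ε : ℝ) (hε : 0 < ε) :
    ∃ δ : ℝ, 0 < δ ∧ ∃ p₀ : ℕ, ∀ p : ℕ, p.Prime → p₀ ≤ p →
      ∃ A : Finset (ZMod p),
        (1 / 2 - ε) * p ≤ (A.card : ℝ) ∧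
        (((A + A.image fun a => l • a).card : ℝ)) ≤ (1 - δ) * p := by
  have h0 : 0 < min ε 1 := lt_min hε one_pos
  have h1 : min ε 1 ≤ 1 := min_le_right _ _
  have h2 : min ε 1 ≤ ε := min_le_left _ _
  have key : ∃ δ : ℝ, 0 < δ ∧ ∃ p₀ : ℕ, ∀ p : ℕ, p.Prime → p₀ ≤ p →
      ∃ A : Finset (ZMod p),
        (1 / 2 - min ε 1) * p ≤ (A.card : ℝ) ∧
        (((A + A.image fun a => l • a).card : ℝ)) ≤ (1 - δ) * p := by
    rcases Nat.lt_or_ge 1 l.natAbs with h | h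
    · exact DilatesAux.big_case l h _ h0 h1
    · exact DilatesAux.small_case l h _ h0 h1
  obtain ⟨δ, hδ, p₀, h⟩ := key
  refine ⟨δ, hδ, p₀, fun p hp hpp => ?_⟩
  obtain ⟨A, hA, hA2⟩ := h p hp hpp
  refine ⟨A, le_trans ?_ hA, hA2⟩
  gcongr
end

section
/- There exists a universal constant C > 0 such that for every ε ∈ (0,1) and every nonzero integer λ, for all sufficiently large primes p there exists a set A ⊆ ℤ/pℤ with |A| ≥ (1/2 − ε)·p and |A + λ·A| ≤ (1 − ε^(C/ε))·p. -/
open Pointwise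

/-- permutations whose maximum along an injective family sits at a given index are rare -/
lemma perm_argmax_count {K M : ℕ} (f : Fin K → Fin M) (hf : Function.Injective f) (j : Fin K) :
    K * (Finset.univ.filter fun σ : Equiv.Perm (Fin M) =>
      ∀ i, i ≠ j → σ (f i) < σ (f j)).card ≤ Fintype.card (Equiv.Perm (Fin M)) := by
  classical
  let S : Fin K → Finset (Equiv.Perm (Fin M)) := fun j =>
    Finset.univ.filter fun σ => ∀ i, i ≠ j → σ (f i) < σ (f j)
  have hcard : ∀ i, (S j).card ≤ (S i).card := by
    intro i
    apply Finset.card_le_card_of_injOn (fun σ => (Equiv.swap (f i) (f j)).trans σ)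
    · intro σ hσ
      simp only [S, Finset.coe_filter, Finset.mem_univ, true_and, Set.mem_ofPred_eq] at hσ ⊢
      intro t ht
      simp only [Equiv.trans_apply, Equiv.swap_apply_left]
      by_cases htj : t = j
      · subst htj
        rw [Equiv.swap_apply_right]
        exact hσ i (Ne.symm ht)
      · rw [Equiv.swap_apply_of_ne_of_ne (hf.ne ht) (hf.ne htj)]
        exact hσ t htj
    · intro σ _ τ _ h
      ext x
      have := congrArg (fun e : Equiv.Perm (Fin M) => e (Equiv.swap (f i) (f j) x)) h
      simpa using congrArg Fin.val this
  have hdisj : ∀ a ∈ (Finset.univ : Finset (Fin K)), ∀ b ∈ (Finset.univ : Finset (Fin K)),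
      a ≠ b → Disjoint (S a) (S b) := by
    intro a _ b _ hab
    rw [Finset.disjoint_left]
    intro σ ha hb
    simp only [S, Finset.mem_filter, Finset.mem_univ, true_and] at ha hb
    exact lt_asymm (ha b hab.symm) (hb a hab)
  calc K * (S j).card = ∑ _i : Fin K, (S j).card := by simp
    _ ≤ ∑ i : Fin K, (S i).card := Finset.sum_le_sum fun i _ => hcard i
    _ = (Finset.univ.biUnion S).card := (Finset.card_biUnion hdisj).symm
    _ ≤ _ := Finset.card_le_univ _

/-- averaging over permutations -/
lemma exists_perm {α : Type*} {K M : ℕ} (X : Finset α) (c : α → Fin K → Fin M)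
    (hc : ∀ x ∈ X, Function.Injective (c x)) (j₁ j₂ : Fin K) :
    ∃ σ : Equiv.Perm (Fin M), ∀ S₁ S₂ : Finset α,
      (∀ x ∈ S₁, x ∈ X ∧ ∀ i, i ≠ j₁ → σ (c x i) < σ (c x j₁)) →
      (∀ x ∈ S₂, x ∈ X ∧ ∀ i, i ≠ j₂ → σ (c x i) < σ (c x j₂)) →
      K * (S₁.card + S₂.card) ≤ 2 * X.card := by
  classical
  have key : ∀ j : Fin K, K * ∑ σ : Equiv.Perm (Fin M),
      (X.filter fun x => ∀ i, i ≠ j → σ (c x i) < σ (c x j)).card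
        ≤ X.card * Fintype.card (Equiv.Perm (Fin M)) := by
    intro j
    have h1 : ∑ σ : Equiv.Perm (Fin M),
      (X.filter fun x => ∀ i, i ≠ j → σ (c x i) < σ (c x j)).card
      = ∑ x ∈ X, (Finset.univ.filter fun σ : Equiv.Perm (Fin M) =>
          ∀ i, i ≠ j → σ (c x i) < σ (c x j)).card := by
      simp only [Finset.card_filter]
      exact Finset.sum_comm
    rw [h1, Finset.mul_sum, ← smul_eq_mul, ← Finset.sum_const]
    exact Finset.sum_le_sum fun x hx => perm_argmax_count (c x) (hc x hx) j
  obtain ⟨σ, -, hσ⟩ := Finset.exists_le_of_sum_le (s := (Finset.univ : Finset (Equiv.Perm (Fin M))))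
    (f := fun σ : Equiv.Perm (Fin M) => K * ((X.filter fun x => ∀ i, i ≠ j₁ → σ (c x i) < σ (c x j₁)).card +
        (X.filter fun x => ∀ i, i ≠ j₂ → σ (c x i) < σ (c x j₂)).card))
    (g := fun _ => 2 * X.card) ⟨1, Finset.mem_univ _⟩ (by
      rw [← Finset.mul_sum, Finset.sum_add_distrib, mul_add]
      refine (add_le_add (key j₁) (key j₂)).trans (le_of_eq ?_)
      simp only [Finset.sum_const, Finset.card_univ, smul_eq_mul]
      ring)
  refine ⟨σ, fun S₁ S₂ h₁ h₂ => le_trans (Nat.mul_le_mul_left K (add_le_add ?_ ?_)) hσ⟩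
  · exact Finset.card_le_card fun x hx => Finset.mem_filter.2 (h₁ x hx)
  · exact Finset.card_le_card fun x hx => Finset.mem_filter.2 (h₂ x hx)

/-- the abstract construction -/
lemma abstract_construction {p : ℕ} [Fact p.Prime] (u : ZMod p) (hu : u ≠ 0) (K N : ℕ) (hK : 2 ≤ K)
    (F : ZMod p → ℤ) (hodd : ∀ x, F (-x) = - F x) (hN : ∀ x, (F x).natAbs ≤ N)
    (E : Finset (ZMod p)) (hE : ∀ x ∈ E, -x ∈ E) (b d : ℕ)
    (hb : (Finset.univ.filter fun y => F y = 0 ∨ ∃ z ∈ E, F (y + z) ≠ F y).card ≤ b)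
    (hd : ∀ i j, i < K → j < K → i ≠ j →
      (Finset.univ.filter fun x => (F (u ^ i * x)).natAbs = (F (u ^ j * x)).natAbs).card ≤ d) :
    ∃ A : Finset (ZMod p), K * p ≤ 2 * K * A.card + 2 * p + K * (K * b + K ^ 2 * d) ∧
      Disjoint (A + A.image fun a => u * a)
        (Finset.univ.filter fun z => ∀ j < K, u ^ j * z ∈ E) := by
  classical
  let Good : ZMod p → Prop := fun y => F y ≠ 0 ∧ ∀ z ∈ E, F (y + z) = F y
  have hGneg : ∀ y, Good y → Good (-y) := by
    rintro y ⟨h1, h2⟩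
    refine ⟨by rw [hodd]; simpa using h1, fun z hz => ?_⟩
    have := h2 (-z) (hE z hz)
    rw [show -y + z = -(y + -z) by ring, hodd, hodd, this]
  let X : Finset (ZMod p) := Finset.univ.filter fun x => (∀ i < K, Good (u ^ i * x)) ∧
    ∀ i < K, ∀ j < K, i ≠ j → (F (u ^ i * x)).natAbs ≠ (F (u ^ j * x)).natAbs
  have hXneg : ∀ x ∈ X, -x ∈ X := by
    intro x hx
    simp only [X, Finset.mem_filter, Finset.mem_univ, true_and] at hx ⊢
    refine ⟨fun i hi => ?_, fun i hi j hj hij => ?_⟩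
    · rw [mul_neg]; exact hGneg _ (hx.1 i hi)
    · rw [mul_neg, mul_neg, hodd, hodd, Int.natAbs_neg, Int.natAbs_neg]
      exact hx.2 i hi j hj hij
  have hXcard : p ≤ X.card + (K * b + K ^ 2 * d) := by
    let Y1 : Finset (ZMod p) := (Finset.range K).biUnion fun i =>
      Finset.univ.filter fun x => F (u ^ i * x) = 0 ∨ ∃ z ∈ E, F (u ^ i * x + z) ≠ F (u ^ i * x)
    let Y2 : Finset (ZMod p) := ((Finset.range K ×ˢ Finset.range K).filter fun q => q.1 ≠ q.2).biUnion
      fun q => Finset.univ.filter fun x => (F (u ^ q.1 * x)).natAbs = (F (u ^ q.2 * x)).natAbs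
    have h1 : Y1.card ≤ K * b := by
      refine Finset.card_biUnion_le.trans ?_
      refine (Finset.sum_le_sum (g := fun _ => b) fun i _ => ?_).trans (by simp)
      refine le_trans ?_ hb
      apply Finset.card_le_card_of_injOn (fun x => u ^ i * x)
      · intro x hx
        simpa using hx
      · intro x _ y _ h
        exact mul_left_cancel₀ (pow_ne_zero i hu) h
    have h2 : Y2.card ≤ K ^ 2 * d := by
      refine Finset.card_biUnion_le.trans ?_
      refine (Finset.sum_le_sum (g := fun _ => d) fun q hq => ?_).trans ?_
      · simp only [Finset.mem_filter, Finset.mem_product, Finset.mem_range] at hq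
        exact hd _ _ hq.1.1 hq.1.2 hq.2
      · rw [Finset.sum_const, smul_eq_mul]
        refine Nat.mul_le_mul_right _ ((Finset.card_filter_le _ _).trans ?_)
        simp [sq]
    have h3 : (Finset.univ : Finset (ZMod p)) ⊆ X ∪ (Y1 ∪ Y2) := by
      intro x _
      by_contra hx
      simp only [Finset.mem_union, not_or] at hx
      obtain ⟨hx0, hx1, hx2⟩ := hx
      apply hx0
      simp only [X, Finset.mem_filter, Finset.mem_univ, true_and]
      constructor
      · intro i hi
        by_contra hbad
        apply hx1
        simp only [Y1, Finset.mem_biUnion, Finset.mem_range, Finset.mem_filter, Finset.mem_univ,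
          true_and]
        refine ⟨i, hi, ?_⟩
        by_contra hcon
        push Not at hcon
        exact hbad hcon
      · intro i hi j hj hij heq
        apply hx2
        simp only [Y2, Finset.mem_biUnion, Finset.mem_range, Finset.mem_filter, Finset.mem_univ,
          true_and, Finset.mem_product]
        exact ⟨(i, j), ⟨⟨hi, hj⟩, hij⟩, heq⟩
    have h4 := Finset.card_le_card h3
    rw [Finset.card_univ, ZMod.card] at h4
    have h5 := Finset.card_union_le X (Y1 ∪ Y2)
    have h6 := Finset.card_union_le Y1 Y2
    omega
  let c : ZMod p → Fin K → Fin (N + 1) := fun x i =>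
    ⟨(F (u ^ (i : ℕ) * x)).natAbs, Nat.lt_succ_of_le (hN _)⟩
  have hcneg : ∀ x i, c (-x) i = c x i := by
    intro x i
    simp only [c, mul_neg, hodd, Int.natAbs_neg]
  have hcinj : ∀ x ∈ X, Function.Injective (c x) := by
    intro x hx i j hij
    by_contra hne
    simp only [X, Finset.mem_filter, Finset.mem_univ, true_and] at hx
    exact hx.2 i i.2 j j.2 (fun h => hne (Fin.ext h)) (by simpa [c] using hij)
  let j₀ : Fin K := ⟨0, by omega⟩
  let j₁ : Fin K := ⟨K - 1, by omega⟩
  obtain ⟨σ, hσ⟩ := exists_perm X c hcinj j₀ j₁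
  let A : Finset (ZMod p) := X.filter fun x => ∃ j : Fin K, j ≠ j₀ ∧ j ≠ j₁ ∧
    0 < F (u ^ (j : ℕ) * x) ∧ ∀ i, i ≠ j → σ (c x i) < σ (c x j)
  refine ⟨A, ?_, ?_⟩
  · have hcov : X ⊆ (A ∪ A.image fun x => -x) ∪
        ((X.filter fun x => ∀ i, i ≠ j₀ → σ (c x i) < σ (c x j₀)) ∪
        (X.filter fun x => ∀ i, i ≠ j₁ → σ (c x i) < σ (c x j₁))) := by
      intro x hx
      obtain ⟨j, -, hj⟩ := Finset.exists_max_image (Finset.univ : Finset (Fin K))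
        (fun i => σ (c x i)) ⟨j₀, Finset.mem_univ _⟩
      have hj' : ∀ i, i ≠ j → σ (c x i) < σ (c x j) := fun i hi =>
        lt_of_le_of_ne (hj i (Finset.mem_univ _)) fun h => hi (hcinj x hx (σ.injective h))
      by_cases h0 : j = j₀
      · subst h0
        exact Finset.mem_union_right _ (Finset.mem_union_left _ (Finset.mem_filter.2 ⟨hx, hj'⟩))
      by_cases h1 : j = j₁
      · rw [h1] at hj'
        exact Finset.mem_union_right _ (Finset.mem_union_right _ (Finset.mem_filter.2 ⟨hx, hj'⟩))
      apply Finset.mem_union_left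
      have hne : F (u ^ (j : ℕ) * x) ≠ 0 := by
        simp only [X, Finset.mem_filter, Finset.mem_univ, true_and] at hx
        exact (hx.1 j j.2).1
      rcases lt_or_gt_of_ne hne with hneg | hpos
      · refine Finset.mem_union_right _ (Finset.mem_image.2 ⟨-x, ?_, neg_neg x⟩)
        refine Finset.mem_filter.2 ⟨hXneg x hx, j, h0, h1, ?_, ?_⟩
        · rw [mul_neg, hodd]; omega
        · simpa only [hcneg] using hj'
      · exact Finset.mem_union_left _ (Finset.mem_filter.2 ⟨hx, j, h0, h1, hpos, hj'⟩)
    have h4 := Finset.card_le_card hcov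
    have h5 := (h4.trans (Finset.card_union_le _ _)).trans
      (add_le_add (Finset.card_union_le _ _) (Finset.card_union_le _ _))
    have h6 : (A.image fun x => -x).card ≤ A.card := Finset.card_image_le
    have h7 : X.card ≤ p := by simpa [ZMod.card] using Finset.card_le_univ X
    have hσ' := hσ (X.filter fun x => ∀ i, i ≠ j₀ → σ (c x i) < σ (c x j₀))
      (X.filter fun x => ∀ i, i ≠ j₁ → σ (c x i) < σ (c x j₁))
      (fun x hx => Finset.mem_filter.1 hx) (fun x hx => Finset.mem_filter.1 hx)
    generalize (X.filter fun x => ∀ i, i ≠ j₀ → σ (c x i) < σ (c x j₀)).card = e0 at h5 hσ'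
    generalize (X.filter fun x => ∀ i, i ≠ j₁ → σ (c x i) < σ (c x j₁)).card = e1 at h5 hσ'
    have h8 : p ≤ 2 * A.card + (e0 + e1) + (K * b + K ^ 2 * d) := by omega
    have h9 := Nat.mul_le_mul_left K h8
    calc K * p ≤ _ := h9
      _ = 2 * K * A.card + K * (e0 + e1) + K * (K * b + K ^ 2 * d) := by ring
      _ ≤ _ := by linarith
  · rw [Finset.disjoint_left]
    intro z hz hzB
    obtain ⟨a, ha, b', hb', rfl⟩ := Finset.mem_add.1 hz
    obtain ⟨b, hb, rfl⟩ := Finset.mem_image.1 hb'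
    simp only [Finset.mem_filter, Finset.mem_univ, true_and] at hzB
    have hrel : ∀ j, j + 1 < K → F (u ^ (j + 1) * b) = - F (u ^ j * a) := by
      intro j hj
      have hX := (Finset.mem_filter.1 ha).1
      simp only [X, Finset.mem_filter, Finset.mem_univ, true_and] at hX
      have h1 := (hX.1 j (by omega)).2 _ (hE _ (hzB j (by omega)))
      rw [show u ^ j * a + -(u ^ j * (a + u * b)) = -(u ^ (j + 1) * b) by ring, hodd] at h1
      omega
    obtain ⟨-, s, hs0, hs1, hspos, hs⟩ := Finset.mem_filter.1 ha
    obtain ⟨-, t, ht0, ht1, htpos, ht⟩ := Finset.mem_filter.1 hb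
    have hs1' : (s : ℕ) + 1 < K := by
      have := s.2
      have : (s : ℕ) ≠ K - 1 := fun h => hs1 (Fin.ext h)
      omega
    have ht0' : (t : ℕ) ≠ 0 := fun h => ht0 (Fin.ext h)
    have htK := t.2
    let s' : Fin K := ⟨s + 1, hs1'⟩
    let t' : Fin K := ⟨t - 1, by omega⟩
    have hcs : c b s' = c a s := by
      apply Fin.ext
      simp only [c, s']
      rw [hrel _ hs1', Int.natAbs_neg]
    have hct : c b t = c a t' := by
      apply Fin.ext
      simp only [c, t']
      have := hrel (t - 1) (by omega)
      rw [Nat.sub_add_cancel (by omega)] at this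
      rw [this, Int.natAbs_neg]
    have hst : s' = t := by
      by_contra hne
      have h1 := ht s' hne
      rw [hcs, hct] at h1
      have hne' : t' ≠ s := by
        intro h
        apply hne
        apply Fin.ext
        have := congrArg Fin.val h
        simp only [t', s'] at this ⊢
        omega
      exact lt_asymm h1 (hs t' hne')
    have h1 := hrel _ hs1'
    have h2 : (t : ℕ) = s + 1 := by rw [← hst]
    rw [h2] at htpos
    omega

/-- the signed cell index -/
def cellF (p W : ℕ) (x : ZMod p) : ℤ := x.valMinAbs.tdiv (W : ℤ)

/-- short interval around zero -/
noncomputable def nearZero (p h : ℕ) : Finset (ZMod p) :=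
  (Finset.Icc (-(h : ℤ)) h).image fun e : ℤ => (e : ZMod p)

lemma cellF_neg {p : ℕ} [Fact p.Prime] (hp : 2 < p) (W : ℕ) (x : ZMod p) :
    cellF p W (-x) = - cellF p W x := by
  unfold cellF
  rw [ZMod.valMinAbs_neg_of_ne_half, Int.neg_tdiv]
  have h := (Fact.out : p.Prime).eq_two_or_odd
  omega

lemma cellF_natAbs {p : ℕ} (W : ℕ) (x : ZMod p) :
    (cellF p W x).natAbs = x.valMinAbs.natAbs / W := by
  unfold cellF
  rw [Int.natAbs_tdiv, Int.natAbs_natCast]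
  rfl

lemma nearZero_neg {p h : ℕ} (x : ZMod p) (hx : x ∈ nearZero p h) : -x ∈ nearZero p h := by
  obtain ⟨e, he, rfl⟩ := Finset.mem_image.1 hx
  rw [Finset.mem_Icc] at he
  exact Finset.mem_image.2 ⟨-e, Finset.mem_Icc.2 (by omega), by push_cast; rfl⟩

lemma cellF_natAbs_le {p W N : ℕ} [NeZero p] (hW : 0 < W) (hN : p ≤ 2 * N * W) (x : ZMod p) :
    (cellF p W x).natAbs ≤ N := by
  rw [cellF_natAbs]
  have := ZMod.natAbs_valMinAbs_le x
  apply Nat.le_of_lt_succ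
  rw [Nat.div_lt_iff_lt_mul hW]
  have : N.succ * W = N * W + W := by rw [Nat.succ_mul]
  have : 2 * N * W = 2 * (N * W) := by ring
  omega

lemma cell_zero_card {p W : ℕ} [NeZero p] (hW : 0 < W) :
    (Finset.univ.filter fun y : ZMod p => (cellF p W y) = 0).card ≤ 2 * W := by
  classical
  have : (Finset.univ.filter fun y : ZMod p => (cellF p W y) = 0) ⊆
      (Finset.Ioo (-(W : ℤ)) W).image fun e : ℤ => (e : ZMod p) := by
    intro y hy
    simp only [Finset.mem_filter, Finset.mem_univ, true_and] at hy
    have h1 := cellF_natAbs W y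
    rw [hy, Int.natAbs_zero, eq_comm, Nat.div_eq_zero_iff] at h1
    exact Finset.mem_image.2 ⟨y.valMinAbs, Finset.mem_Ioo.2 (by omega), ZMod.coe_valMinAbs y⟩
  refine (Finset.card_le_card this).trans (Finset.card_image_le.trans ?_)
  rw [Int.card_Ioo]
  omega

lemma dvd_of_div_ne {n W : ℕ} (h : (n + 1) / W ≠ n / W) : W ∣ n + 1 := by
  by_contra hc
  rw [Nat.succ_div, if_neg hc] at h
  exact h rfl

lemma jump_card {p W N : ℕ} [Fact p.Prime] (hp : 2 < p) (hW : 0 < W) (hN : p ≤ 2 * N * W) :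
    (Finset.univ.filter fun y : ZMod p => cellF p W (y + 1) ≠ cellF p W y).card ≤ 4 * N + 3 := by
  classical
  have hodd := (Fact.out : p.Prime).eq_two_or_odd
  have hsub : (Finset.univ.filter fun y : ZMod p => cellF p W (y + 1) ≠ cellF p W y) ⊆
      ((Finset.Icc (-(N : ℤ)) N).image fun m => ((m * W - 1 : ℤ) : ZMod p)) ∪
      (((Finset.Icc (-(N : ℤ)) N).image fun m => ((m * W : ℤ) : ZMod p)) ∪
        {(((p : ℤ) / 2 : ℤ) : ZMod p)}) := by
    intro y hy
    simp only [Finset.mem_filter, Finset.mem_univ, true_and] at hy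
    have hm := ZMod.valMinAbs_mem_Ioc y
    have hcast := ZMod.coe_valMinAbs y
    have hbd : ∀ m : ℤ, 2 * |m * W| ≤ p → m ∈ Finset.Icc (-(N : ℤ)) N := by
      intro m hm
      rw [abs_mul, Nat.abs_cast] at hm
      have h2 : (p : ℤ) ≤ 2 * N * W := by exact_mod_cast hN
      have h3 : |m| ≤ N := by
        have : (0 : ℤ) < W := by exact_mod_cast hW
        nlinarith
      rw [Finset.mem_Icc]
      exact abs_le.1 h3
    obtain ⟨v, hv⟩ : ∃ v, v = y.valMinAbs := ⟨_, rfl⟩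
    rw [← hv] at hm hcast
    rw [Set.mem_Ioc] at hm
    by_cases hend : v = (p : ℤ) / 2
    · apply Finset.mem_union_right
      apply Finset.mem_union_right
      rw [Finset.mem_singleton, ← hend, hcast]
    have hsucc : (y + 1).valMinAbs = v + 1 := by
      rw [ZMod.valMinAbs_spec]
      refine ⟨by rw [← hcast]; push_cast; rfl, ?_⟩
      rw [Set.mem_Ioc]
      omega
    unfold cellF at hy
    rw [hsucc, ← hv] at hy
    rcases le_or_gt 0 v with h0 | h0
    · obtain ⟨n, rfl⟩ := Int.eq_ofNat_of_zero_le h0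
      have h1 : (n + 1) / W ≠ n / W := by
        intro h
        apply hy
        have := congrArg (fun t : ℕ => (t : ℤ)) h
        rw [Int.tdiv_eq_ediv_of_nonneg (by omega), Int.tdiv_eq_ediv_of_nonneg (by omega)]
        exact_mod_cast h
      obtain ⟨m, hm'⟩ := dvd_of_div_ne h1
      apply Finset.mem_union_left
      have hmz : (m : ℤ) * W = n + 1 := by rw [mul_comm]; exact_mod_cast hm'.symm
      refine Finset.mem_image.2 ⟨m, hbd m ?_, ?_⟩
      · rw [hmz, abs_of_nonneg (by omega)]; omega
      · rw [hmz, ← hcast]; push_cast; ring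
    · obtain ⟨n, hn⟩ : ∃ n : ℕ, v = -((n : ℤ) + 1) := ⟨(-v - 1).toNat, by omega⟩
      have h1 : (n + 1) / W ≠ n / W := by
        intro h
        apply hy
        rw [hn, show -((n : ℤ) + 1) + 1 = -(n : ℤ) by ring, Int.neg_tdiv, Int.neg_tdiv,
          Int.tdiv_eq_ediv_of_nonneg (by omega), Int.tdiv_eq_ediv_of_nonneg (by omega)]
        congr 1
        exact_mod_cast h.symm
      obtain ⟨m, hm'⟩ := dvd_of_div_ne h1
      apply Finset.mem_union_right
      apply Finset.mem_union_left
      have hmz : (-(m : ℤ)) * W = v := by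
        rw [hn, neg_mul, mul_comm]; congr 1; exact_mod_cast hm'.symm
      refine Finset.mem_image.2 ⟨-(m : ℤ), hbd _ ?_, ?_⟩
      · rw [hmz, abs_of_neg h0]; omega
      · rw [hmz, hcast]
  refine (Finset.card_le_card hsub).trans ?_
  refine (Finset.card_union_le _ _).trans ?_
  have h1 := Finset.card_image_le (s := Finset.Icc (-(N : ℤ)) N)
    (f := fun m => ((m * W - 1 : ℤ) : ZMod p))
  have h2 := Finset.card_image_le (s := Finset.Icc (-(N : ℤ)) N)
    (f := fun m => ((m * W : ℤ) : ZMod p))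
  have h3 := Finset.card_union_le ((Finset.Icc (-(N : ℤ)) N).image fun m => ((m * W : ℤ) : ZMod p))
    {(((p : ℤ) / 2 : ℤ) : ZMod p)}
  rw [Finset.card_singleton] at h3
  rw [Int.card_Icc] at h1 h2
  omega

lemma bad_card {p W N h : ℕ} [Fact p.Prime] (hp : 2 < p) (hW : 0 < W) (hN : p ≤ 2 * N * W) :
    (Finset.univ.filter fun y : ZMod p => cellF p W y = 0 ∨
      ∃ z ∈ nearZero p h, cellF p W (y + z) ≠ cellF p W y).card
      ≤ 2 * W + (4 * N + 3) * (2 * h + 1) := by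
  classical
  let D := Finset.univ.filter fun y : ZMod p => cellF p W (y + 1) ≠ cellF p W y
  have hsub : (Finset.univ.filter fun y : ZMod p => cellF p W y = 0 ∨
      ∃ z ∈ nearZero p h, cellF p W (y + z) ≠ cellF p W y) ⊆
      (Finset.univ.filter fun y : ZMod p => cellF p W y = 0) ∪
      (D ×ˢ Finset.Icc (-(h : ℤ)) h).image fun q => q.1 - (q.2 : ZMod p) := by
    intro y hy
    simp only [Finset.mem_filter, Finset.mem_univ, true_and] at hy
    rcases hy with hy | ⟨z, hz, hne⟩
    · exact Finset.mem_union_left _ (by simpa using hy)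
    apply Finset.mem_union_right
    by_contra hcon
    have hstep : ∀ t : ℤ, -(h : ℤ) ≤ t → t ≤ h →
        cellF p W (y + ((t + 1 : ℤ) : ZMod p)) = cellF p W (y + (t : ZMod p)) := by
      intro t h1 h2
      by_contra hne'
      apply hcon
      refine Finset.mem_image.2 ⟨(y + (t : ZMod p), t), ?_, by simp⟩
      refine Finset.mem_product.2 ⟨?_, Finset.mem_Icc.2 ⟨h1, h2⟩⟩
      simp only [D, Finset.mem_filter, Finset.mem_univ, true_and]
      push_cast at hne'
      rwa [add_assoc]
    have hup : ∀ n : ℕ, n ≤ h → cellF p W (y + ((n : ℤ) : ZMod p)) = cellF p W y := by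
      intro n
      induction n with
      | zero => intro _; simp
      | succ n ih =>
        intro hn
        rw [← ih (by omega), ← hstep n (by omega) (by omega)]
        push_cast; rfl
    have hdown : ∀ n : ℕ, n ≤ h → cellF p W (y + ((-(n : ℤ) : ℤ) : ZMod p)) = cellF p W y := by
      intro n
      induction n with
      | zero => intro _; simp
      | succ n ih =>
        intro hn
        rw [← ih (by omega)]
        have := hstep (-((n + 1 : ℕ) : ℤ)) (by omega) (by omega)
        rw [← this]
        congr 3
        push_cast; ring
    obtain ⟨e, he, rfl⟩ := Finset.mem_image.1 hz
    rw [Finset.mem_Icc] at he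
    apply hne
    rcases le_or_gt 0 e with h0 | h0
    · obtain ⟨n, rfl⟩ := Int.eq_ofNat_of_zero_le h0
      exact hup n (by omega)
    · obtain ⟨n, rfl⟩ : ∃ n : ℕ, e = -(n : ℤ) := ⟨(-e).toNat, by omega⟩
      exact hdown n (by omega)
  refine (Finset.card_le_card hsub).trans ((Finset.card_union_le _ _).trans ?_)
  refine add_le_add (cell_zero_card hW) (Finset.card_image_le.trans ?_)
  rw [Finset.card_product, Int.card_Icc]
  refine Nat.mul_le_mul (jump_card hp hW hN) (by omega)

lemma small_mul_card {p W : ℕ} [Fact p.Prime] (w : ZMod p) (hw : w ≠ 0) :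
    (Finset.univ.filter fun x : ZMod p => ∃ e ∈ Finset.Ioo (-(W : ℤ)) W, w * x = (e : ZMod p)).card
      ≤ 2 * W := by
  classical
  have h1 : (Finset.univ.filter fun x : ZMod p =>
      ∃ e ∈ Finset.Ioo (-(W : ℤ)) W, w * x = (e : ZMod p)).card ≤
      ((Finset.Ioo (-(W : ℤ)) W).image fun e : ℤ => (e : ZMod p)).card := by
    apply Finset.card_le_card_of_injOn (fun x => w * x)
    · intro x hx
      obtain ⟨-, e, he, h⟩ := Finset.mem_filter.1 (Finset.mem_coe.1 hx)
      exact Finset.mem_coe.2 (Finset.mem_image.2 ⟨e, he, h.symm⟩)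
    · intro x _ y _ h
      exact mul_left_cancel₀ hw h
  refine h1.trans (Finset.card_image_le.trans ?_)
  rw [Int.card_Ioo]
  omega

lemma coll_card {p W : ℕ} [Fact p.Prime] (hW : 0 < W) (w w' : ZMod p) (h1 : w - w' ≠ 0)
    (h2 : w + w' ≠ 0) :
    (Finset.univ.filter fun x : ZMod p =>
      (cellF p W (w * x)).natAbs = (cellF p W (w' * x)).natAbs).card ≤ 4 * W := by
  classical
  have hsub : (Finset.univ.filter fun x : ZMod p =>
      (cellF p W (w * x)).natAbs = (cellF p W (w' * x)).natAbs) ⊆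
      (Finset.univ.filter fun x : ZMod p =>
        ∃ e ∈ Finset.Ioo (-(W : ℤ)) W, (w - w') * x = (e : ZMod p)) ∪
      (Finset.univ.filter fun x : ZMod p =>
        ∃ e ∈ Finset.Ioo (-(W : ℤ)) W, (w + w') * x = (e : ZMod p)) := by
    intro x hx
    simp only [Finset.mem_filter, Finset.mem_univ, true_and, Finset.mem_union,
      cellF_natAbs] at hx ⊢
    have e1 := ZMod.coe_valMinAbs (w * x)
    have e2 := ZMod.coe_valMinAbs (w' * x)
    generalize (w * x).valMinAbs = a at hx e1
    generalize (w' * x).valMinAbs = b at hx e2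
    have ha := Nat.div_add_mod a.natAbs W
    have hb := Nat.div_add_mod b.natAbs W
    have ha' := Nat.mod_lt a.natAbs hW
    have hb' := Nat.mod_lt b.natAbs hW
    rw [hx] at ha
    generalize W * (b.natAbs / W) = q at ha hb
    by_cases hs : (0 ≤ a ∧ 0 ≤ b) ∨ (a < 0 ∧ b < 0)
    · left
      refine ⟨a - b, Finset.mem_Ioo.2 (by omega), ?_⟩
      rw [sub_mul, ← e1, ← e2]; push_cast; rfl
    · right
      refine ⟨a + b, Finset.mem_Ioo.2 (by omega), ?_⟩
      rw [add_mul, ← e1, ← e2]; push_cast; rfl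
  refine (Finset.card_le_card hsub).trans ((Finset.card_union_le _ _).trans ?_)
  have := small_mul_card (W := W) (w - w') h1
  have := small_mul_card (W := W) (w + w') h2
  omega

lemma bohr_card {p h H K : ℕ} [Fact p.Prime] (u : ZMod p) (hH : p ≤ H * (h + 1)) :
    p ≤ H ^ K * (Finset.univ.filter fun z : ZMod p => ∀ j < K, u ^ j * z ∈ nearZero p h).card := by
  classical
  set B := Finset.univ.filter fun z : ZMod p => ∀ j < K, u ^ j * z ∈ nearZero p h with hB
  let f : ZMod p → (Fin K → Fin H) := fun x i =>
    ⟨(u ^ (i : ℕ) * x).val / (h + 1), by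
      rw [Nat.div_lt_iff_lt_mul (by omega)]
      exact (ZMod.val_lt _).trans_le hH⟩
  have hfib : ∀ b ∈ (Finset.univ : Finset (Fin K → Fin H)),
      ((Finset.univ : Finset (ZMod p)).filter fun x => f x = b).card ≤ B.card := by
    intro b _
    rcases ((Finset.univ : Finset (ZMod p)).filter fun x => f x = b).eq_empty_or_nonempty with he | ⟨y, hy⟩
    · rw [he]; simp
    · apply Finset.card_le_card_of_injOn (fun x => x - y)
      · intro x hx
        have hx' := (Finset.mem_filter.1 (Finset.mem_coe.1 hx)).2
        have hy' := (Finset.mem_filter.1 hy).2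
        refine Finset.mem_coe.2 (Finset.mem_filter.2 ⟨Finset.mem_univ _, fun j hj => ?_⟩)
        have hq : (u ^ j * x).val / (h + 1) = (u ^ j * y).val / (h + 1) := by
          have := congrFun (hx'.trans hy'.symm) ⟨j, hj⟩
          simpa [f] using this
        have c1 := ZMod.natCast_zmod_val (u ^ j * x)
        have c2 := ZMod.natCast_zmod_val (u ^ j * y)
        generalize (u ^ j * x).val = a at hq c1
        generalize (u ^ j * y).val = c at hq c2
        have ha := Nat.div_add_mod a (h + 1)
        have hb := Nat.div_add_mod c (h + 1)
        have ha' := Nat.mod_lt a (show h + 1 > 0 by omega)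
        have hb' := Nat.mod_lt c (show h + 1 > 0 by omega)
        rw [hq] at ha
        generalize (h + 1) * (c / (h + 1)) = q at ha hb
        refine Finset.mem_image.2 ⟨(a : ℤ) - c, Finset.mem_Icc.2 (by omega), ?_⟩
        rw [mul_sub, ← c1, ← c2]; push_cast; rfl
      · intro x _ x' _ h
        exact sub_left_injective h
  have := Finset.card_le_mul_card_image_of_maps_to (s := (Finset.univ : Finset (ZMod p)))
    (t := (Finset.univ : Finset (Fin K → Fin H))) (f := f) (fun _ _ => Finset.mem_univ _) B.card hfib
  simpa [ZMod.card, mul_comm] using this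

lemma pow_sub_add_ne {l : ℤ} (hl : 2 ≤ l.natAbs) {K p i j : ℕ} (hp : 2 * l.natAbs ^ K < p)
    (hi : i < K) (hj : j < K) (hij : i ≠ j) :
    ((l : ZMod p) ^ i - (l : ZMod p) ^ j ≠ 0) ∧ ((l : ZMod p) ^ i + (l : ZMod p) ^ j ≠ 0) := by
  have hne : l.natAbs ^ i ≠ l.natAbs ^ j := fun h => hij (Nat.pow_right_injective hl h)
  have h1 : l.natAbs ^ i ≤ l.natAbs ^ K := Nat.pow_le_pow_right (by omega) hi.le
  have h2 : l.natAbs ^ j ≤ l.natAbs ^ K := Nat.pow_le_pow_right (by omega) hj.le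
  rw [← Int.natAbs_pow] at h1 h2 hne
  rw [← Int.natAbs_pow] at hne
  constructor
  · intro h
    have h' : ((l ^ i - l ^ j : ℤ) : ZMod p) = 0 := by push_cast; exact h
    rw [ZMod.intCast_zmod_eq_zero_iff_dvd] at h'
    have := Int.eq_zero_of_dvd_of_natAbs_lt_natAbs h' (by omega)
    omega
  · intro h
    have h' : ((l ^ i + l ^ j : ℤ) : ZMod p) = 0 := by push_cast; exact h
    rw [ZMod.intCast_zmod_eq_zero_iff_dvd] at h'
    have := Int.eq_zero_of_dvd_of_natAbs_lt_natAbs h' (by omega)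
    omega

lemma big_case {l : ℤ} (hl : 2 ≤ l.natAbs) {n p : ℕ} (hn : 1 ≤ n) (hprime : p.Prime)
    (hp1 : 2 * l.natAbs ^ (4 * n) < p) (hp2 : 2 ^ 14 * n ^ 5 ≤ p) :
    ∃ A : Finset (ZMod p), n * p ≤ 2 * n * A.card + 2 * p ∧
      ∃ B : ℕ, (A + A.image fun a => l • a).card + B ≤ p ∧ p ≤ (2 ^ 14 * n ^ 5) ^ (4 * n) * B := by
  classical
  haveI : Fact p.Prime := ⟨hprime⟩
  have hn5 : 1 ≤ n ^ 5 := Nat.one_le_pow _ _ hn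
  have hn3 : 1 ≤ n ^ 3 := Nat.one_le_pow _ _ hn
  have hn35 : n ^ 3 ≤ n ^ 5 := Nat.pow_le_pow_right hn (by omega)
  have hn23 : n ^ 2 ≤ n ^ 3 := Nat.pow_le_pow_right hn (by omega)
  obtain ⟨W, hWdef⟩ : ∃ W, W = p / (128 * n ^ 3) := ⟨_, rfl⟩
  obtain ⟨h, hhdef⟩ : ∃ h, h = p / (2 ^ 14 * n ^ 5) := ⟨_, rfl⟩
  have hW : 0 < W := by rw [hWdef]; exact Nat.div_pos (by omega) (by omega)
  have hh : 0 < h := by rw [hhdef]; exact Nat.div_pos (by omega) (by omega)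
  have hWle : 128 * n ^ 3 * W ≤ p := by rw [hWdef]; exact Nat.mul_div_le _ _
  have hhle : 2 ^ 14 * n ^ 5 * h ≤ p := by rw [hhdef]; exact Nat.mul_div_le _ _
  have hWlt : p < 128 * n ^ 3 * (W + 1) := by
    rw [hWdef]; exact Nat.lt_mul_div_succ _ (by omega)
  have hhlt : p < 2 ^ 14 * n ^ 5 * (h + 1) := by
    rw [hhdef]; exact Nat.lt_mul_div_succ _ (by omega)
  have hN : p ≤ 2 * (128 * n ^ 3) * W := by
    have : 128 * n ^ 3 * 1 ≤ 128 * n ^ 3 * W := Nat.mul_le_mul_left _ hW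
    nlinarith
  have hu : (l : ZMod p) ≠ 0 := by
    intro h0
    have := (pow_sub_add_ne hl hp1 (i := 1) (j := 2) (by omega) (by omega) (by omega)).1
    rw [h0] at this
    simp at this
  obtain ⟨A, hA, hdis⟩ := abstract_construction (l : ZMod p) hu (4 * n) (128 * n ^ 3) (by omega)
    (cellF p W) (cellF_neg (by omega) W) (cellF_natAbs_le hW hN) (nearZero p h) nearZero_neg
    (2 * W + (4 * (128 * n ^ 3) + 3) * (2 * h + 1)) (4 * W)
    (bad_card (by omega) hW hN)
    (fun i j hi hj hij => by
      have := pow_sub_add_ne hl hp1 hi hj hij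
      exact coll_card hW _ _ this.1 this.2)
  refine ⟨A, ?_, _, ?_, bohr_card (K := 4 * n) (l : ZMod p) hhlt.le⟩
  · have e1 : n ^ 2 * W ≤ n ^ 3 * W := Nat.mul_le_mul_right _ hn23
    have e2 : (4 * (128 * n ^ 3) + 3) * (2 * h + 1) ≤ (515 * n ^ 3) * (3 * h) :=
      Nat.mul_le_mul (by omega) (by omega)
    have e3 : n ^ 2 * ((4 * (128 * n ^ 3) + 3) * (2 * h + 1)) ≤ n ^ 2 * ((515 * n ^ 3) * (3 * h)) :=
      Nat.mul_le_mul_left _ e2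
    have e4 : n ^ 2 * ((515 * n ^ 3) * (3 * h)) = 1545 * (n ^ 5 * h) := by ring
    generalize (4 * (128 * n ^ 3) + 3) * (2 * h + 1) = Q at hA e3
    have e5 : 4 * n * (4 * n * (2 * W + Q) + (4 * n) ^ 2 * (4 * W)) =
      32 * (n ^ 2 * W) + 16 * (n ^ 2 * Q) + 256 * (n ^ 3 * W) := by ring
    rw [e5] at hA
    nlinarith
  · have h1 : (A.image fun a => l • a) = A.image fun a => (l : ZMod p) * a := by
      simp only [zsmul_eq_mul]
    rw [h1, ← Finset.card_union_of_disjoint hdis]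
    exact (Finset.card_le_univ _).trans (le_of_eq (ZMod.card p))

lemma unit_case {l : ℤ} (hl : l = 1 ∨ l = -1) {m p : ℕ} (hprime : p.Prime) (hm : m ≤ p) :
    ∃ A : Finset (ZMod p), A.card = m ∧ (A + A.image fun a => l • a).card ≤ 2 * m := by
  classical
  haveI : Fact p.Prime := ⟨hprime⟩
  refine ⟨(Finset.range m).image fun a : ℕ => (a : ZMod p), ?_, ?_⟩
  · rw [Finset.card_image_of_injOn, Finset.card_range]
    intro a ha b hb hab
    simp only [Finset.coe_range, Set.mem_Iio] at ha hb
    have := congrArg ZMod.val hab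
    simpa [ZMod.val_natCast, Nat.mod_eq_of_lt (ha.trans_le hm), Nat.mod_eq_of_lt (hb.trans_le hm)]
      using this
  · have hex : ∃ s : ℕ, ∀ a < m, ∀ b < m, ∃ t < 2 * m,
        (a : ZMod p) + l • (b : ZMod p) = (t : ZMod p) - s := by
      rcases hl with rfl | rfl
      · exact ⟨0, fun a ha b hb => ⟨a + b, by omega, by simp⟩⟩
      · refine ⟨m, fun a ha b hb => ⟨a + m - b, by omega, ?_⟩⟩
        rw [Nat.cast_sub (by omega)]
        push_cast
        simp
        ring
    obtain ⟨s, hs⟩ := hex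
    have hsub : (((Finset.range m).image fun a : ℕ => (a : ZMod p)) +
      ((Finset.range m).image fun a : ℕ => (a : ZMod p)).image fun a => l • a) ⊆
        (Finset.range (2 * m)).image fun t : ℕ => (t : ZMod p) - s := by
      intro z hz
      obtain ⟨x, hx, y, hy, rfl⟩ := Finset.mem_add.1 hz
      obtain ⟨y', hy', rfl⟩ := Finset.mem_image.1 hy
      obtain ⟨a, ha, rfl⟩ := Finset.mem_image.1 hx
      obtain ⟨b, hb, rfl⟩ := Finset.mem_image.1 hy'
      obtain ⟨t, ht, h⟩ := hs a (Finset.mem_range.1 ha) b (Finset.mem_range.1 hb)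
      exact Finset.mem_image.2 ⟨t, Finset.mem_range.2 ht, h.symm⟩
    exact (Finset.card_le_card hsub).trans (Finset.card_image_le.trans (by simp))

lemma param_bound {ε : ℝ} (h0 : 0 < ε) (h1 : ε < 1 / 2) {n : ℕ} (hn : 1 ≤ n)
    (hn2 : (n : ℝ) ≤ 2 / ε) :
    ε ^ (192 / ε) * (((2 ^ 14 * n ^ 5) ^ (4 * n) : ℕ) : ℝ) ≤ 1 := by
  have hnε : (n : ℝ) * ε ≤ 2 := by rwa [le_div_iff₀ h0] at hn2
  have hn1 : (1 : ℝ) ≤ n := by exact_mod_cast hn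
  have hH : (2 ^ 14 * (n : ℝ) ^ 5) * ε ^ 24 ≤ 1 := by
    have a1 : ((n : ℝ) * ε) ^ 5 ≤ 2 ^ 5 := pow_le_pow_left₀ (by positivity) hnε 5
    have a2 : ε ^ 19 ≤ (1 / 2) ^ 19 := pow_le_pow_left₀ h0.le h1.le 19
    calc (2 ^ 14 * (n : ℝ) ^ 5) * ε ^ 24 = 2 ^ 14 * ((n * ε) ^ 5 * ε ^ 19) := by ring
      _ ≤ 2 ^ 14 * (2 ^ 5 * (1 / 2) ^ 19) := by gcongr
      _ = 1 := by norm_num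
  have he : ε ^ (192 / ε) ≤ (ε ^ 24) ^ (4 * n) := by
    rw [← pow_mul, ← Real.rpow_natCast]
    apply Real.rpow_le_rpow_of_exponent_ge h0 (by linarith)
    push_cast
    rw [show 192 / ε = 96 * (2 / ε) by ring]
    linarith
  rw [show (((2 ^ 14 * n ^ 5) ^ (4 * n) : ℕ) : ℝ) = (2 ^ 14 * (n : ℝ) ^ 5) ^ (4 * n) by
    push_cast; norm_num]
  calc ε ^ (192 / ε) * (2 ^ 14 * (n : ℝ) ^ 5) ^ (4 * n)
      ≤ (ε ^ 24) ^ (4 * n) * (2 ^ 14 * (n : ℝ) ^ 5) ^ (4 * n) := by gcongr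
    _ = ((2 ^ 14 * (n : ℝ) ^ 5) * ε ^ 24) ^ (4 * n) := by rw [← mul_pow, mul_comm]
    _ ≤ 1 := pow_le_one₀ (by positivity) hH

theorem sums_of_dilates_large_density_quantitative :
    ∃ C : ℝ, 0 < C ∧ ∀ ε : ℝ, 0 < ε → ε < 1 → ∀ l : ℤ, l ≠ 0 →
      ∃ p₀ : ℕ, ∀ p : ℕ, p.Prime → p₀ ≤ p →
        ∃ A : Finset (ZMod p),
          (1 / 2 - ε) * p ≤ (A.card : ℝ) ∧
          (((A + A.image fun a => l • a).card : ℝ)) ≤ (1 - ε ^ (C / ε)) * p := by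
  refine ⟨192, by norm_num, fun ε h0 h1 l hl => ?_⟩
  rcases le_or_gt (1 / 2) ε with hε | hε
  · refine ⟨0, fun p _ _ => ⟨∅, ?_, ?_⟩⟩
    · have : (0 : ℝ) ≤ p := Nat.cast_nonneg p
      simp only [Finset.card_empty, Nat.cast_zero]
      nlinarith
    · simp only [Finset.empty_add, Finset.card_empty, Nat.cast_zero]
      have : ε ^ (192 / ε) ≤ 1 := Real.rpow_le_one h0.le h1.le (by positivity)
      exact mul_nonneg (by linarith) (Nat.cast_nonneg p)
  by_cases hl1 : l = 1 ∨ l = -1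
  · refine ⟨⌈2 / ε⌉₊, fun p hprime hp => ?_⟩
    have hp' : 2 / ε ≤ p := Nat.ceil_le.1 hp
    rw [div_le_iff₀ h0] at hp'
    have hpos : (0 : ℝ) ≤ p := Nat.cast_nonneg p
    have hm : ⌈(1 / 2 - ε) * p⌉₊ ≤ p := Nat.ceil_le.2 (by nlinarith)
    obtain ⟨A, hA, hS⟩ := unit_case hl1 hprime hm
    refine ⟨A, ?_, ?_⟩
    · rw [hA]; exact Nat.le_ceil _
    · have h2 : ε ^ (192 / ε) ≤ ε := by
        conv_rhs => rw [← Real.rpow_one ε]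
        apply Real.rpow_le_rpow_of_exponent_ge h0 h1.le
        rw [le_div_iff₀ h0]; linarith
      have h3 := Nat.ceil_lt_add_one (a := (1 / 2 - ε) * (p : ℝ))
        (mul_nonneg (by linarith) hpos)
      have hS' : ((A + A.image fun a => l • a).card : ℝ) ≤ 2 * (⌈(1 / 2 - ε) * (p : ℝ)⌉₊ : ℝ) := by
        exact_mod_cast hS
      nlinarith
  · have hl2 : 2 ≤ l.natAbs := by omega
    obtain ⟨n, hn⟩ : ∃ n, n = ⌈1 / ε⌉₊ := ⟨_, rfl⟩
    have hinv : 2 ≤ 1 / ε := by rw [le_div_iff₀ h0]; linarith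
    have hn_ge : 1 / ε ≤ n := by rw [hn]; exact Nat.le_ceil _
    have hn_lt : (n : ℝ) < 1 / ε + 1 := by
      rw [hn]; exact Nat.ceil_lt_add_one (by positivity)
    have hn1 : 1 ≤ n := by
      have : (1 : ℝ) ≤ n := by linarith
      exact_mod_cast this
    have hn2 : (n : ℝ) ≤ 2 / ε := by
      rw [show 2 / ε = 1 / ε + 1 / ε by ring]; linarith
    refine ⟨2 * l.natAbs ^ (4 * n) + 1 + 2 ^ 14 * n ^ 5, fun p hprime hp => ?_⟩
    obtain ⟨A, hA, B, hB, hBp⟩ := big_case hl2 hn1 hprime (by omega) (by omega)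
    have hpos : (0 : ℝ) ≤ p := Nat.cast_nonneg p
    have hnε : 1 ≤ (n : ℝ) * ε := by rwa [div_le_iff₀ h0] at hn_ge
    have hn0 : (0 : ℝ) < n := by exact_mod_cast hn1
    refine ⟨A, ?_, ?_⟩
    · have hA' : (n : ℝ) * p ≤ 2 * n * A.card + 2 * p := by exact_mod_cast hA
      have : (n : ℝ) * ((1 / 2 - ε) * p) ≤ n * A.card := by nlinarith
      exact le_of_mul_le_mul_left this hn0
    · have hb := param_bound h0 hε hn1 hn2
      have hB' : ((A + A.image fun a => l • a).card : ℝ) + B ≤ p := by exact_mod_cast hB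
      have hBp' : (p : ℝ) ≤ (((2 ^ 14 * n ^ 5) ^ (4 * n) : ℕ) : ℝ) * B := by exact_mod_cast hBp
      generalize (((2 ^ 14 * n ^ 5) ^ (4 * n) : ℕ) : ℝ) = Q at hb hBp'
      have hq : 0 < ε ^ (192 / ε) := Real.rpow_pos_of_pos h0 _
      have hB0 : (0 : ℝ) ≤ B := Nat.cast_nonneg B
      have h5 : ε ^ (192 / ε) * p ≤ B := by
        calc ε ^ (192 / ε) * p ≤ ε ^ (192 / ε) * (Q * B) := by gcongr
          _ = (ε ^ (192 / ε) * Q) * B := by ring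
          _ ≤ 1 * B := by gcongr
          _ = B := one_mul _
      linarith
end

section
/- Let λ be an integer with |λ| ≥ 2. For every ε > 0 there exists a measurable set A ⊆ 𝕋 with μ(A) > 1/2 − ε such that A ∩ λ·A = ∅. -/
open MeasureTheory

/-- Points whose first hitting time of `I` under `T` is exactly `k`. -/
def hitSet {α : Type*} (T : α → α) (I : Set α) : ℕ → Set α
  | 0 => I
  | k + 1 => (T ⁻¹' hitSet T I k) \ I

theorem hitSet_measurable {α : Type*} [MeasurableSpace α] {T : α → α} {I : Set α}
    (hT : Measurable T) (hI : MeasurableSet I) (k : ℕ) : MeasurableSet (hitSet T I k) := by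
  induction k with
  | zero => exact hI
  | succ k ih => exact (hT ih).diff hI

theorem hitSet_inj {α : Type*} {T : α → α} {I : Set α} (a : ℕ) :
    ∀ (b : ℕ) (x : α), x ∈ hitSet T I a → x ∈ hitSet T I b → a = b := by
  induction a with
  | zero =>
    intro b x ha hb
    cases b with
    | zero => rfl
    | succ b => exact absurd ha hb.2
  | succ a ih =>
    intro b x ha hb
    cases b with
    | zero => exact absurd hb ha.2
    | succ b => rw [ih b (T x) ha.1 hb.1]

theorem exists_large_set_disjoint_dilate (l : ℤ) (hl : 2 ≤ |l|)
    (ε : ℝ) (hε : 0 < ε) :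
    ∃ A : Set UnitAddCircle, MeasurableSet A ∧
      ENNReal.ofReal (1 / 2 - ε) < volume A ∧
      A ∩ ((fun x => l • x) '' A) = ∅ := by
  have herg : Ergodic (fun x : UnitAddCircle => l • x) volume :=
    AddCircle.ergodic_zsmul (T := 1) (by omega)
  set T : UnitAddCircle → UnitAddCircle := fun x => l • x with hTdef
  obtain ⟨δ, hδ0, hδε, hδ4⟩ : ∃ δ : ℝ, 0 < δ ∧ δ < ε ∧ δ < 1 / 4 := by
    refine ⟨min ε (1 / 4) / 2, by positivity, ?_, ?_⟩
    · have := min_le_left ε (1 / 4)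
      linarith
    · have := min_le_right ε (1 / 4)
      linarith
  set I : Set UnitAddCircle := Metric.closedBall 0 δ with hIdef
  have hIm : MeasurableSet I := Metric.isClosed_closedBall.measurableSet
  have hIv : volume.real I = 2 * δ := by
    rw [Measure.real, hIdef, AddCircle.volume_closedBall, ENNReal.toReal_ofReal]
    · exact min_eq_right (by linarith)
    · positivity
  have hTm : Measurable T := herg.measurable
  have hSm := hitSet_measurable hTm hIm
  set Ev : Set UnitAddCircle := ⋃ k, hitSet T I (2 * k) with hEv
  set Od : Set UnitAddCircle := ⋃ k, hitSet T I (2 * k + 1) with hOd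
  set U : Set UnitAddCircle := ⋃ k, hitSet T I k with hU
  have hEm : MeasurableSet Ev := MeasurableSet.iUnion fun k => hSm _
  have hOm : MeasurableSet Od := MeasurableSet.iUnion fun k => hSm _
  have hUm : MeasurableSet U := MeasurableSet.iUnion fun k => hSm _
  have hIU : I ⊆ U := fun x hx => Set.mem_iUnion.2 ⟨0, hx⟩
  have hTU : T ⁻¹' U ⊆ U := by
    intro x hx
    by_cases hxI : x ∈ I
    · exact hIU hxI
    · obtain ⟨k, hk⟩ := Set.mem_iUnion.1 hx
      exact Set.mem_iUnion.2 ⟨k + 1, hk, hxI⟩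
  have hU1 : volume.real U = 1 := by
    rcases herg.ae_empty_or_univ_of_preimage_ae_le hUm.nullMeasurableSet
      (Filter.Eventually.of_forall hTU) with h | h
    · have h0 : volume.real U = 0 := by simp [measureReal_congr h]
      have := measureReal_mono (μ := volume) hIU
      linarith
    · rw [measureReal_congr h, Measure.real, UnitAddCircle.measure_univ, ENNReal.toReal_one]
  have hUsub : U ⊆ Ev ∪ Od := by
    intro x hx
    obtain ⟨k, hk⟩ := Set.mem_iUnion.1 hx
    obtain ⟨m, rfl | rfl⟩ := Nat.even_or_odd' k
    · exact Or.inl (Set.mem_iUnion.2 ⟨m, hk⟩)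
    · exact Or.inr (Set.mem_iUnion.2 ⟨m, hk⟩)
  have hTE : T ⁻¹' Ev ⊆ Od ∪ I := by
    intro x hx
    by_cases hxI : x ∈ I
    · exact Or.inr hxI
    · obtain ⟨k, hk⟩ := Set.mem_iUnion.1 hx
      exact Or.inl (Set.mem_iUnion.2 ⟨k, hk, hxI⟩)
  have hEp : volume.real (T ⁻¹' Ev) = volume.real Ev :=
    herg.toMeasurePreserving.measureReal_preimage hEm.nullMeasurableSet
  have h1 : volume.real U ≤ volume.real Ev + volume.real Od :=
    (measureReal_mono hUsub).trans (measureReal_union_le _ _)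
  have h2 : volume.real (T ⁻¹' Ev) ≤ volume.real Od + volume.real I :=
    (measureReal_mono hTE).trans (measureReal_union_le _ _)
  have h3 : 1 / 2 - δ ≤ volume.real Od := by linarith
  refine ⟨Od, hOm, ?_, ?_⟩
  · rw [← ofReal_measureReal (μ := volume) (s := Od)]
    exact (ENNReal.ofReal_lt_ofReal_iff (by linarith)).2 (by linarith)
  · rw [Set.eq_empty_iff_forall_notMem]
    rintro _ ⟨hy, x, hx, rfl⟩
    obtain ⟨k, hk⟩ := Set.mem_iUnion.1 hx
    obtain ⟨m, hm⟩ := Set.mem_iUnion.1 hy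
    have := hitSet_inj _ _ _ hk.1 hm
    omega
end
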